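/- arXiv:2006.04450 — 12 statements merged into one kernel-verified Lean document; each statement's English description precedes it below -/
import Mathlib

section
/- A lattice X satisfies the identity L(x,a,y,b,z) = U(x,a,y,b,z) for all x, a, y, b, z ∈ X if and only if X is distributive (i.e. x ⊓ (y ⊔ z) = (x ⊓ y) ⊔ (x ⊓ z) for all x, y, z ∈ X). -/
/-- The quintary map `L` of a lattice. -/
def latticeL {X : Type*} [Lattice X] (x a y b z : X) : X :=
  (b ⊓ (z ⊔ (a ⊓ y))) ⊔ (z ⊓ (b ⊔ (x ⊓ y))) ⊔ (x ⊓ (a ⊔ (z ⊓ y))) ⊔ (a ⊓ (x ⊔ (b ⊓ y)))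

/-- The quintary map `U` of a lattice. -/
def latticeU {X : Type*} [Lattice X] (x a y b z : X) : X :=
  (a ⊔ (z ⊓ (b ⊔ y))) ⊓ (x ⊔ (b ⊓ (z ⊔ y))) ⊓ (z ⊔ (a ⊓ (x ⊔ y))) ⊓ (b ⊔ (x ⊓ (a ⊔ y)))

theorem Order.Ideal.IsPrime.inf_mem_iff {X : Type*} [Lattice X] {I : Order.Ideal X}
    (hI : I.IsPrime) {x y : X} : x ⊓ y ∈ I ↔ x ∈ I ∨ y ∈ I :=
  ⟨hI.mem_or_mem, fun h => h.elim (I.lower inf_le_left) (I.lower inf_le_right)⟩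

/-- Prime ideals separate the elements of a distributive lattice. -/
theorem DistribLattice.le_of_forall_isPrime {X : Type*} [DistribLattice X] {p q : X}
    (h : ∀ I : Order.Ideal X, I.IsPrime → q ∈ I → p ∈ I) : p ≤ q := by
  by_contra hpq
  have hdisj : Disjoint (Order.PFilter.principal p : Set X) (Order.Ideal.principal q : Set X) := by
    rw [Set.disjoint_left]
    intro x hx hx'
    exact hpq (le_trans (Order.PFilter.mem_principal.1 hx) (Order.Ideal.mem_principal.1 hx'))
  obtain ⟨I, hI, hqI, hIp⟩ := DistribLattice.prime_ideal_of_disjoint_filter_ideal hdisj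
  exact Set.disjoint_left.1 hIp (Order.PFilter.mem_principal.2 le_rfl)
    (h I hI (hqI Order.Ideal.mem_principal_self))

theorem latticeL_eq_latticeU {X : Type*} [DistribLattice X] (x a y b z : X) :
    latticeL x a y b z = latticeU x a y b z := by
  apply le_antisymm <;>
  · refine DistribLattice.le_of_forall_isPrime fun I hI => ?_
    simp only [latticeL, latticeU, hI.inf_mem_iff, Order.Ideal.sup_mem_iff]
    grind

/-- A modular lattice in which the median and the dual median agree is distributive. -/
theorem inf_sup_eq_of_median_le {X : Type*} [Lattice X] [IsModularLattice X]
    (h : ∀ x y z : X,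
      (x ⊔ y) ⊓ (x ⊔ z) ⊓ (y ⊔ z) ≤ x ⊓ y ⊔ x ⊓ z ⊔ y ⊓ z) (x y z : X) :
    x ⊓ (y ⊔ z) = x ⊓ y ⊔ x ⊓ z := by
  apply le_antisymm _ le_inf_sup
  calc x ⊓ (y ⊔ z)
      ≤ (x ⊓ y ⊔ x ⊓ z ⊔ y ⊓ z) ⊓ x := by
        refine le_inf (le_trans ?_ (h x y z)) inf_le_left
        exact le_inf (le_inf (inf_le_left.trans le_sup_left) (inf_le_left.trans le_sup_left))
          inf_le_right
    _ = (x ⊓ y ⊔ x ⊓ z) ⊔ y ⊓ z ⊓ x :=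
        sup_inf_assoc_of_le _ (sup_le inf_le_left inf_le_left)
    _ ≤ x ⊓ y ⊔ x ⊓ z :=
        sup_le le_rfl (le_sup_of_le_left (le_inf inf_le_right (inf_le_left.trans inf_le_left)))

theorem isModularLattice_of_latticeL_eq_latticeU {X : Type*} [Lattice X]
    (h : ∀ x a y b z : X, latticeL x a y b z = latticeU x a y b z) : IsModularLattice X where
  sup_inf_le_assoc_of_le := by
    intro c e d hcd
    have := h e d c c c
    simp [latticeL, latticeU, hcd] at this
    rw [inf_comm, sup_comm c e]
    exact this.le

/-- A lattice satisfies the identity `L = U` iff it is distributive. -/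
theorem L_eq_U_iff_distrib {X : Type*} [Lattice X] :
    (∀ x a y b z : X, latticeL x a y b z = latticeU x a y b z) ↔
    (∀ x y z : X, x ⊓ (y ⊔ z) = (x ⊓ y) ⊔ (x ⊓ z)) := by
  constructor
  · intro h
    have := isModularLattice_of_latticeL_eq_latticeU h
    refine inf_sup_eq_of_median_le fun x a y => ?_
    calc (x ⊔ a) ⊓ (x ⊔ y) ⊓ (a ⊔ y)
        ≤ latticeU x a y a x := by
          have hx : x ⊔ a ⊓ (x ⊔ y) = (x ⊔ a) ⊓ (x ⊔ y) := (sup_inf_assoc_of_le a le_sup_left).symm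
          have ha : a ⊔ x ⊓ (a ⊔ y) = (a ⊔ x) ⊓ (a ⊔ y) := (sup_inf_assoc_of_le x le_sup_left).symm
          simp only [latticeU, hx, ha]
          grind
      _ = latticeL x a y a x := (h x a y a x).symm
      _ ≤ x ⊓ a ⊔ x ⊓ y ⊔ a ⊓ y := by
          have hx : x ⊓ (a ⊔ x ⊓ y) = a ⊓ x ⊔ x ⊓ y := by
            rw [inf_comm, sup_comm, sup_inf_assoc_of_le a inf_le_left, sup_comm]
          have ha : a ⊓ (x ⊔ a ⊓ y) = x ⊓ a ⊔ a ⊓ y := by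
            rw [inf_comm, sup_comm, sup_inf_assoc_of_le x inf_le_left, sup_comm]
          simp only [latticeL, hx, ha]
          grind
  · intro h x a y b z
    let _ : DistribLattice X := DistribLattice.ofInfSupLe fun x y z => (h x y z).le
    exact latticeL_eq_latticeU x a y b z
end

section
/- In a distributive lattice X, for all x, a, y, b, z ∈ X one has L(x,a,y,b,z) = (a ⊓ x) ⊔ (b ⊓ z) ⊔ (a ⊓ b ⊓ y) ⊔ (x ⊓ y ⊓ z) and U(x,a,y,b,z) = (a ⊔ z) ⊓ (x ⊔ b) ⊓ (a ⊔ b ⊔ y) ⊓ (x ⊔ y ⊔ z). -/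
/-- In a distributive lattice, `L` and `U` simplify to four-term join/meet expressions. -/
theorem L_U_simplified {X : Type*} [DistribLattice X] (x a y b z : X) :
    latticeL x a y b z = (a ⊓ x) ⊔ (b ⊓ z) ⊔ (a ⊓ b ⊓ y) ⊔ (x ⊓ y ⊓ z) ∧
    latticeU x a y b z = (a ⊔ z) ⊓ (x ⊔ b) ⊓ (a ⊔ b ⊔ y) ⊓ (x ⊔ y ⊔ z) := by
  constructor
  · simp only [latticeL, inf_sup_left, inf_comm, inf_left_comm, sup_comm, sup_left_comm,
      sup_assoc, sup_idem, sup_left_idem]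
  · simp only [latticeU, sup_inf_left, inf_comm, inf_left_comm, sup_comm, sup_left_comm,
      inf_idem, inf_left_idem]
end

section
/- If a lattice X satisfies the inequality L(x,a,y,b,z) ≤ U(x,a,y,b,z) for all x, a, y, b, z ∈ X, then X is modular (i.e. for all p, q, r ∈ X with p ≤ r, p ⊔ (q ⊓ r) = (p ⊔ q) ⊓ r). -/
/-- If a lattice satisfies `L ≤ U`, then it is modular. -/
theorem modular_of_L_le_U {X : Type*} [Lattice X]
    (h : ∀ x a y b z : X, latticeL x a y b z ≤ latticeU x a y b z) :
    ∀ p q r : X, p ≤ r → p ⊔ (q ⊓ r) = (p ⊔ q) ⊓ r := by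
  intro p q r hpr
  refine le_antisymm (sup_le (le_inf le_sup_left hpr) (inf_le_inf_right r le_sup_right)) ?_
  calc (p ⊔ q) ⊓ r = r ⊓ (q ⊔ (p ⊓ p)) := by rw [inf_idem, inf_comm, sup_comm]
    _ ≤ latticeL p p p r q := le_sup_of_le_left (le_sup_of_le_left le_sup_left)
    _ ≤ latticeU p p p r q := h p p p r q
    _ ≤ p ⊔ (q ⊓ (r ⊔ p)) := inf_le_of_left_le (inf_le_of_left_le inf_le_left)
    _ = p ⊔ (q ⊓ r) := by rw [sup_eq_left.2 hpr]
end

section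
/- Let W be a module over a unital ring K, and let X be the lattice of all submodules of W, with meet given by intersection and join given by sum of submodules. Then for all submodules x, a, y, b, z of W, L(x,a,y,b,z) ≤ U(x,a,y,b,z), i.e. (b ⊓ (z ⊔ (a ⊓ y))) ⊔ (z ⊓ (b ⊔ (x ⊓ y))) ⊔ (x ⊓ (a ⊔ (z ⊓ y))) ⊔ (a ⊓ (x ⊔ (b ⊓ y))) is contained in (a ⊔ (z ⊓ (b ⊔ y))) ⊓ (x ⊔ (b ⊓ (z ⊔ y))) ⊓ (z ⊔ (a ⊓ (x ⊔ y))) ⊓ (b ⊔ (x ⊓ (a ⊔ y))). -/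
section ModularLattice

variable {α : Type*} [Lattice α]

theorem inf_sup_inf_le_sup_inf_sup [IsModularLattice α] (p q r s : α) :
    p ⊓ (q ⊔ r ⊓ s) ≤ r ⊔ q ⊓ (p ⊔ s) :=
  calc p ⊓ (q ⊔ r ⊓ s) ≤ (r ⊓ s ⊔ q) ⊓ (p ⊔ s) :=
        le_inf (inf_le_right.trans_eq (sup_comm _ _)) (inf_le_left.trans le_sup_left)
    _ = r ⊓ s ⊔ q ⊓ (p ⊔ s) := sup_inf_assoc_of_le q (inf_le_right.trans le_sup_right)
    _ ≤ r ⊔ q ⊓ (p ⊔ s) := sup_le_sup_right inf_le_left _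

theorem inf_sup_inf_le_sup_inf_sup_right (p q r s t : α) :
    p ⊓ (q ⊔ r ⊓ s) ≤ q ⊔ r ⊓ (t ⊔ s) :=
  inf_le_right.trans (sup_le_sup_left (inf_le_inf_left r le_sup_right) q)

theorem inf_sup_inf_le_sup_inf_sup_left (p q r s t : α) :
    p ⊓ (q ⊔ r ⊓ s) ≤ t ⊔ p ⊓ (q ⊔ s) :=
  (inf_le_inf_left p (sup_le_sup_left inf_le_right q)).trans le_sup_right

theorem inf_sup_inf_le_four_inf [IsModularLattice α] (p q r t s : α) :
    p ⊓ (q ⊔ r ⊓ s) ≤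
      (r ⊔ q ⊓ (p ⊔ s)) ⊓ (t ⊔ p ⊓ (q ⊔ s)) ⊓ (q ⊔ r ⊓ (t ⊔ s)) ⊓ (p ⊔ t ⊓ (r ⊔ s)) :=
  le_inf (le_inf (le_inf (inf_sup_inf_le_sup_inf_sup p q r s)
    (inf_sup_inf_le_sup_inf_sup_left p q r s t))
    (inf_sup_inf_le_sup_inf_sup_right p q r s t)) (inf_le_left.trans le_sup_left)

end ModularLattice

/-- In the lattice of submodules of a module `W` over a unital ring `K`
(meet = intersection, join = sum), the inequality `L ≤ U` holds. -/
theorem submodule_L_le_U {K : Type*} [Ring K] {W : Type*} [AddCommGroup W] [Module K W]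
    (x a y b z : Submodule K W) :
    (b ⊓ (z ⊔ (a ⊓ y))) ⊔ (z ⊓ (b ⊔ (x ⊓ y))) ⊔ (x ⊓ (a ⊔ (z ⊓ y))) ⊔ (a ⊓ (x ⊔ (b ⊓ y))) ≤
    (a ⊔ (z ⊓ (b ⊔ y))) ⊓ (x ⊔ (b ⊓ (z ⊔ y))) ⊓ (z ⊔ (a ⊓ (x ⊔ y))) ⊓ (b ⊔ (x ⊓ (a ⊔ y))) := by
  refine sup_le (sup_le (sup_le ?_ ?_) ?_) ?_
  · exact inf_sup_inf_le_four_inf b z a x y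
  · exact (inf_sup_inf_le_four_inf z b x a y).trans_eq (by ac_rfl)
  · exact (inf_sup_inf_le_four_inf x a z b y).trans_eq (by ac_rfl)
  · exact (inf_sup_inf_le_four_inf a x b z y).trans_eq (by ac_rfl)
end

section
/- In any lattice X, for all x, y, z, a, b ∈ X the following 'diagonal' values of L and U agree: (1) L(x,z,y,x,z) = z ⊓ x = U(x,z,y,x,z); (2) L(x,x,y,z,z) = x ⊔ z = U(x,x,y,z,z); (3) L(x,y,y,y,z) = y = U(x,y,y,y,z). -/
/-- Diagonal values of `L` and `U` agree in any lattice. -/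
theorem diagonal_values {X : Type*} [Lattice X] (x y z : X) :
    (latticeL x z y x z = z ⊓ x ∧ latticeU x z y x z = z ⊓ x) ∧
    (latticeL x x y z z = x ⊔ z ∧ latticeU x x y z z = x ⊔ z) ∧
    (latticeL x y y y z = y ∧ latticeU x y y y z = y) := by
  refine ⟨⟨?_, ?_⟩, ⟨?_, ?_⟩, ?_, ?_⟩ <;>
    simp [latticeL, latticeU, inf_comm, sup_comm]
end

section
/- Let X be a distributive lattice and x, a, b, z ∈ X. Define L⁽¹⁾ := (b ⊓ a) ⊔ (z ⊓ x), L⁽²⁾ := (b ⊓ x) ⊔ (a ⊓ z), L⁽³⁾ := (b ⊓ z) ⊔ (a ⊓ x), U⁽¹⁾ := (a ⊔ b) ⊓ (z ⊔ x), U⁽²⁾ := (a ⊔ z) ⊓ (b ⊔ x), U⁽³⁾ := (a ⊔ x) ⊓ (b ⊔ z). Then for every choice {i,j,k} = {1,2,3}: U⁽ⁱ⁾ ⊓ U⁽ʲ⁾ = L⁽ᵏ⁾ and L⁽ⁱ⁾ ⊔ L⁽ʲ⁾ = U⁽ᵏ⁾. -/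
theorem sup_inf_sup_inf_sup_inf_sup {X : Type*} [DistribLattice X] (p q r s : X) :
    ((p ⊔ q) ⊓ (r ⊔ s)) ⊓ ((p ⊔ r) ⊓ (q ⊔ s)) = (q ⊓ r) ⊔ (p ⊓ s) := by
  rw [inf_inf_inf_comm, ← sup_inf_left, ← sup_inf_right, inf_comm r q, sup_comm p,
    ← sup_inf_left]

theorem inf_sup_inf_sup_inf_sup_inf {X : Type*} [DistribLattice X] (p q r s : X) :
    ((p ⊓ q) ⊔ (r ⊓ s)) ⊔ ((p ⊓ r) ⊔ (q ⊓ s)) = (q ⊔ r) ⊓ (p ⊔ s) :=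
  sup_inf_sup_inf_sup_inf_sup (X := Xᵒᵈ) p q r s

/-- In a distributive lattice, the six elements `L⁽ⁱ⁾, U⁽ⁱ⁾` (i = 1,2,3) built from
`x, a, b, z` satisfy `U⁽ⁱ⁾ ⊓ U⁽ʲ⁾ = L⁽ᵏ⁾` and `L⁽ⁱ⁾ ⊔ L⁽ʲ⁾ = U⁽ᵏ⁾`
for every choice `{i,j,k} = {1,2,3}`. -/
theorem cube_relations {X : Type*} [DistribLattice X] (x a b z : X)
    (L1 L2 L3 U1 U2 U3 : X)
    (hL1 : L1 = (b ⊓ a) ⊔ (z ⊓ x)) (hL2 : L2 = (b ⊓ x) ⊔ (a ⊓ z)) (hL3 : L3 = (b ⊓ z) ⊔ (a ⊓ x))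
    (hU1 : U1 = (a ⊔ b) ⊓ (z ⊔ x)) (hU2 : U2 = (a ⊔ z) ⊓ (b ⊔ x)) (hU3 : U3 = (a ⊔ x) ⊓ (b ⊔ z)) :
    (U1 ⊓ U2 = L3 ∧ U1 ⊓ U3 = L2 ∧ U2 ⊓ U3 = L1) ∧
    (L1 ⊔ L2 = U3 ∧ L1 ⊔ L3 = U2 ∧ L2 ⊔ L3 = U1) := by
  subst hL1 hL2 hL3 hU1 hU2 hU3
  refine ⟨⟨?_, ?_, ?_⟩, ?_, ?_, ?_⟩
  · exact sup_inf_sup_inf_sup_inf_sup a b z x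
  · simpa only [sup_comm x z] using sup_inf_sup_inf_sup_inf_sup a b x z
  · simpa only [sup_comm x b, sup_comm z b, inf_comm a b, sup_comm (z ⊓ x)] using
      sup_inf_sup_inf_sup_inf_sup a z x b
  · simpa only [inf_comm x z] using inf_sup_inf_sup_inf_sup_inf b a x z
  · exact inf_sup_inf_sup_inf_sup_inf b a z x
  · simpa only [inf_comm z a, inf_comm x a, sup_comm x z, sup_comm b a,
      inf_comm (z ⊔ x)] using inf_sup_inf_sup_inf_sup_inf b x z a
end

section
/- For all natural numbers x, a, y, b, z: gcd(lcm(a,x), gcd(lcm(b,z), gcd(lcm(a,lcm(b,y)), lcm(x,lcm(y,z))))) = lcm(gcd(a,z), lcm(gcd(x,b), lcm(gcd(a,gcd(b,y)), gcd(x,gcd(y,z))))), i.e. gcd(lcm(a,x), lcm(b,z), lcm(a,b,y), lcm(x,y,z)) = lcm(gcd(a,z), gcd(x,b), gcd(a,b,y), gcd(x,y,z)). -/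
theorem Nat.Prime.pow_dvd_lcm_iff_or {p : ℕ} (hp : p.Prime) (k m n : ℕ) :
    p ^ k ∣ Nat.lcm m n ↔ p ^ k ∣ m ∨ p ^ k ∣ n := by
  refine ⟨fun h => ?_, fun h => h.elim (·.trans (Nat.dvd_lcm_left m n))
    (·.trans (Nat.dvd_lcm_right m n))⟩
  rcases eq_or_ne m 0 with rfl | hm
  · simp
  rcases eq_or_ne n 0 with rfl | hn
  · simp
  rw [hp.pow_dvd_iff_le_factorization (Nat.lcm_ne_zero hm hn), Nat.factorization_lcm hm hn,
    Finsupp.sup_apply, le_sup_iff] at h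
  rwa [hp.pow_dvd_iff_le_factorization hm, hp.pow_dvd_iff_le_factorization hn]

theorem Nat.eq_of_forall_prime_pow_dvd_iff {m n : ℕ}
    (h : ∀ p k : ℕ, p.Prime → (p ^ k ∣ m ↔ p ^ k ∣ n)) : m = n :=
  Nat.dvd_antisymm
    ((Nat.dvd_iff_prime_pow_dvd_dvd n m).2 fun p k hp => (h p k hp).1)
    ((Nat.dvd_iff_prime_pow_dvd_dvd m n).2 fun p k hp => (h p k hp).2)


/-- The arithmetic identity: for natural numbers,
`gcd(lcm(a,x), lcm(b,z), lcm(a,b,y), lcm(x,y,z)) =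
 lcm(gcd(a,z), gcd(x,b), gcd(a,b,y), gcd(x,y,z))`. -/
theorem arithmetic_identity (x a y b z : ℕ) :
    Nat.gcd (Nat.lcm a x) (Nat.gcd (Nat.lcm b z)
      (Nat.gcd (Nat.lcm a (Nat.lcm b y)) (Nat.lcm x (Nat.lcm y z)))) =
    Nat.lcm (Nat.gcd a z) (Nat.lcm (Nat.gcd x b)
      (Nat.lcm (Nat.gcd a (Nat.gcd b y)) (Nat.gcd x (Nat.gcd y z)))) := by
  refine Nat.eq_of_forall_prime_pow_dvd_iff fun p k hp => ?_
  simp only [Nat.dvd_gcd_iff, hp.pow_dvd_lcm_iff_or]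
  tauto
end

section
/- Let M be a linearly ordered set. For all a, b, x, y, z ∈ M: max(min(a,x), min(b,z), min(a, min(b,y)), min(x, min(y,z))) = min(max(a,z), max(x,b), max(a, max(b,y)), max(x, max(y,z))), where max and min of several arguments are iterated binary max and min. -/
/-- In a linear order, the max-min identity
`max(min(a,x), min(b,z), min(a,b,y), min(x,y,z)) =
 min(max(a,z), max(x,b), max(a,b,y), max(x,y,z))` holds. -/
theorem chain_identity {M : Type*} [LinearOrder M] (a b x y z : M) :
    max (min a x) (max (min b z) (max (min a (min b y)) (min x (min y z)))) =
    min (max a z) (min (max x b) (min (max a (max b y)) (max x (max y z)))) := by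
  refine eq_of_forall_lt_iff fun c => ?_
  simp only [lt_min_iff, lt_max_iff]
  tauto
end

section
/- Let M be a set and a, b, x, y, z ⊆ M. Then (a ∩ x) ∪ (b ∩ z) ∪ (a ∩ b ∩ y) ∪ (x ∩ y ∩ z) = (a ∪ z) ∩ (x ∪ b) ∩ (a ∪ b ∪ y) ∩ (x ∪ y ∪ z). -/
/-- The Boolean (power set) identity:
`(a ∩ x) ∪ (b ∩ z) ∪ (a ∩ b ∩ y) ∪ (x ∩ y ∩ z) =
 (a ∪ z) ∩ (x ∪ b) ∩ (a ∪ b ∪ y) ∩ (x ∪ y ∪ z)`. -/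
theorem powerset_identity {M : Type*} (a b x y z : Set M) :
    (a ∩ x) ∪ (b ∩ z) ∪ (a ∩ b ∩ y) ∪ (x ∩ y ∩ z) =
    (a ∪ z) ∩ (x ∪ b) ∩ (a ∪ b ∪ y) ∩ (x ∪ y ∪ z) := by
  ext m
  simp only [Set.mem_union, Set.mem_inter_iff]
  tauto
end

section
/- Let M be a linearly ordered set, regarded as a lattice with ⊓ = min and ⊔ = max, and let x, a, y, b, z ∈ M. If a ≤ y and y ≤ b, then L(x,a,y,b,z) = U(x,a,y,b,z) = max(a, min(z,b)) = min(max(a,z), b). -/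
/-- In a distributive lattice, `L` is the median of `a`, `z`, `b` when `a ≤ y ≤ b`. -/
theorem latticeL_eq_of_le_of_le {X : Type*} [DistribLattice X] {x a y b z : X}
    (hay : a ≤ y) (hyb : y ≤ b) : latticeL x a y b z = a ⊔ (z ⊓ b) := by
  have hb : b ⊓ (z ⊔ a) = a ⊔ (z ⊓ b) := by
    rw [inf_sup_left, inf_eq_right.2 (hay.trans hyb), sup_comm, inf_comm]
  rw [latticeL, inf_eq_left.2 hay, hb, sup_eq_left.2 (inf_le_right.trans hyb),
    sup_eq_left.2 (le_sup_right : z ⊓ b ≤ a ⊔ (z ⊓ b)),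
    sup_eq_left.2 (inf_le_right.trans (sup_le_sup_left (inf_le_inf_left z hyb) a)),
    sup_eq_left.2 (inf_le_left.trans le_sup_left)]

/-- In a distributive lattice, `U` is the median of `a`, `z`, `b` when `a ≤ y ≤ b`. -/
theorem latticeU_eq_of_le_of_le {X : Type*} [DistribLattice X] {x a y b z : X}
    (hay : a ≤ y) (hyb : y ≤ b) : latticeU x a y b z = a ⊔ (z ⊓ b) := by
  rw [latticeU, sup_eq_left.2 hyb, inf_eq_left.2 (hay.trans le_sup_right)]
  refine le_antisymm (inf_le_left.trans (inf_le_left.trans inf_le_left)) ?_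
  have hb : a ⊔ (z ⊓ b) ≤ b := sup_le (hay.trans hyb) inf_le_right
  refine le_inf (le_inf (le_inf le_rfl ?_) ?_) (hb.trans le_sup_left)
  · exact (le_inf hb (sup_le (hay.trans le_sup_right) (inf_le_left.trans le_sup_left))).trans
      le_sup_right
  · exact sup_le le_sup_right (inf_le_left.trans le_sup_left)

/-- In a linear order (lattice with `⊓ = min`, `⊔ = max`), if `a ≤ y ≤ b`, then
`L = U = max(a, min(z,b)) = min(max(a,z), b)`. -/
theorem chain_case_a_le_y_le_b {M : Type*} [LinearOrder M] (x a y b z : M)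
    (hay : a ≤ y) (hyb : y ≤ b) :
    latticeL x a y b z = latticeU x a y b z ∧
    latticeL x a y b z = max a (min z b) ∧
    latticeL x a y b z = min (max a z) b := by
  have hL := latticeL_eq_of_le_of_le (x := x) (z := z) hay hyb
  refine ⟨hL.trans (latticeU_eq_of_le_of_le hay hyb).symm, hL, hL.trans ?_⟩
  rw [inf_sup_right, inf_eq_left.2 (hay.trans hyb)]
end

section
/- Let X be a distributive lattice. (i) Fix x, y, b ∈ X; then the product u ∘ v := L(x,u,y,b,v) is associative: L(x, L(x,u,y,b,v), y, b, w) = L(x, u, y, b, L(x,v,y,b,w)) for all u, v, w ∈ X. (ii) Fix x, a, y ∈ X; then the product u ∗ v := L(x,a,y,u,v) is associative: L(x, a, y, L(x,a,y,u,v), w) = L(x, a, y, u, L(x,a,y,v,w)) for all u, v, w ∈ X. -/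
theorem latticeL_eq_inf_sup_inf {X : Type*} [DistribLattice X] (x a y b z : X) :
    latticeL x a y b z = (a ⊓ (x ⊔ (b ⊓ y))) ⊔ (z ⊓ (b ⊔ (x ⊓ y))) := by
  simp only [latticeL, inf_sup_left]
  ac_rfl

theorem latticeL_eq_sup_of_inf {X : Type*} [DistribLattice X] (x a y b z : X) :
    latticeL x a y b z = (b ⊓ z) ⊔ (x ⊓ a) ⊔ (b ⊓ (a ⊓ y)) ⊔ (z ⊓ (x ⊓ y)) := by
  simp only [latticeL, inf_sup_left]
  ac_rfl

theorem inf_sup_inf_assoc {X : Type*} [DistribLattice X] (p q u v w : X) :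
    (((u ⊓ p) ⊔ (v ⊓ q)) ⊓ p) ⊔ (w ⊓ q) = (u ⊓ p) ⊔ (((v ⊓ p) ⊔ (w ⊓ q)) ⊓ q) := by
  rw [inf_sup_right, inf_sup_right, inf_assoc u, inf_idem, inf_assoc w, inf_idem,
    inf_right_comm v q p, sup_assoc]

theorem inf_sup_sup_inf_comp_left {X : Type*} [DistribLattice X] {c d e : X} (h : d ⊓ e ≤ c)
    (u v w : X) :
    (((u ⊓ v) ⊔ c ⊔ (u ⊓ d) ⊔ (v ⊓ e)) ⊓ w) ⊔ c ⊔ (((u ⊓ v) ⊔ c ⊔ (u ⊓ d) ⊔ (v ⊓ e)) ⊓ d) ⊔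
        (w ⊓ e) =
      (u ⊓ v ⊓ w) ⊔ c ⊔ (u ⊓ d) ⊔ (w ⊓ e) := by
  apply le_antisymm
  · have ht : u ⊓ v ⊓ w ≤ (u ⊓ v ⊓ w) ⊔ c ⊔ (u ⊓ d) ⊔ (w ⊓ e) :=
      le_sup_left.trans (le_sup_left.trans le_sup_left)
    have hc : c ≤ (u ⊓ v ⊓ w) ⊔ c ⊔ (u ⊓ d) ⊔ (w ⊓ e) :=
      le_sup_right.trans (le_sup_left.trans le_sup_left)
    have hd : u ⊓ d ≤ (u ⊓ v ⊓ w) ⊔ c ⊔ (u ⊓ d) ⊔ (w ⊓ e) := le_sup_right.trans le_sup_left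
    have he : w ⊓ e ≤ (u ⊓ v ⊓ w) ⊔ c ⊔ (u ⊓ d) ⊔ (w ⊓ e) := le_sup_right
    refine sup_le (sup_le (sup_le ?_ hc) ?_) he
    · rw [inf_sup_right, inf_sup_right, inf_sup_right]
      exact sup_le (sup_le (sup_le ht (inf_le_left.trans hc)) (inf_le_left.trans hd))
        ((le_inf inf_le_right (inf_le_left.trans inf_le_right)).trans he)
    · rw [inf_sup_right, inf_sup_right, inf_sup_right]
      exact sup_le (sup_le (sup_le ((inf_le_inf_right d inf_le_left).trans hd)
        (inf_le_left.trans hc)) (inf_le_left.trans hd))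
        ((le_inf inf_le_right (inf_le_left.trans inf_le_right)).trans (h.trans hc))
  · refine sup_le_sup_right (sup_le_sup (sup_le_sup_right (inf_le_inf_right w ?_) c) ?_) (w ⊓ e)
    · exact le_sup_left.trans (le_sup_left.trans le_sup_left)
    · exact le_inf (le_sup_right.trans le_sup_left) inf_le_right

/-- If `d ⊓ e ≤ c`, the product `u, v ↦ (u ⊓ v) ⊔ c ⊔ (u ⊓ d) ⊔ (v ⊓ e)` is associative. -/
theorem inf_sup_sup_inf_assoc {X : Type*} [DistribLattice X] {c d e : X} (h : d ⊓ e ≤ c)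
    (u v w : X) :
    (((u ⊓ v) ⊔ c ⊔ (u ⊓ d) ⊔ (v ⊓ e)) ⊓ w) ⊔ c ⊔ (((u ⊓ v) ⊔ c ⊔ (u ⊓ d) ⊔ (v ⊓ e)) ⊓ d) ⊔
        (w ⊓ e) =
      (u ⊓ ((v ⊓ w) ⊔ c ⊔ (v ⊓ d) ⊔ (w ⊓ e))) ⊔ c ⊔ (u ⊓ d) ⊔
        (((v ⊓ w) ⊔ c ⊔ (v ⊓ d) ⊔ (w ⊓ e)) ⊓ e) := by
  have hswap := inf_sup_sup_inf_comp_left (inf_comm d e ▸ h) w v u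
  rw [inf_comm w v, sup_right_comm (v ⊓ w ⊔ c), inf_comm _ u, sup_right_comm _ _ (u ⊓ d),
    inf_comm (v ⊓ w) u, ← inf_assoc, sup_right_comm _ (w ⊓ e)] at hswap
  rw [inf_sup_sup_inf_comp_left h, hswap]

/-- In a distributive lattice, the parastrophe products
`u ∘ v := L(x,u,y,b,v)` (for fixed `x, y, b`) and
`u ∗ v := L(x,a,y,u,v)` (for fixed `x, a, y`) are associative. -/
theorem parastrophe_products_assoc {X : Type*} [DistribLattice X] :
    (∀ x y b : X, ∀ u v w : X,
      latticeL x (latticeL x u y b v) y b w = latticeL x u y b (latticeL x v y b w)) ∧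
    (∀ x a y : X, ∀ u v w : X,
      latticeL x a y (latticeL x a y u v) w = latticeL x a y u (latticeL x a y v w)) := by
  refine ⟨fun x y b u v w => ?_, fun x a y u v w => ?_⟩
  · simp only [latticeL_eq_inf_sup_inf]
    exact inf_sup_inf_assoc _ _ u v w
  · simp only [latticeL_eq_sup_of_inf]
    exact inf_sup_sup_inf_assoc
      (le_inf (inf_le_right.trans inf_le_left) (inf_le_left.trans inf_le_left)) u v w
end

section
/- Let a, y, b be natural numbers with lcm(a, lcm(y, b)) ≠ 0, and for natural numbers x, z define P(x,z) := gcd(lcm(b, gcd(z, lcm(a,y))), gcd(lcm(z, gcd(b, lcm(x,y))), gcd(lcm(x, gcd(a, lcm(z,y))), lcm(a, gcd(x, lcm(b,y)))))). Then: (1) for all x, z, gcd(a, gcd(y, b)) divides P(x,z) and P(x,z) divides lcm(a, lcm(y, b)); (2) P is periodic: if x ≡ x' (mod lcm(y,b)) then P(x,z) = P(x',z) for all z, and if z ≡ z' (mod lcm(y,a)) then P(x,z) = P(x,z') for all x. -/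
/-- The principal product `P(x,z) = L(x,a,y,b,z)` in the arithmetic lattice
`(ℕ, ⊓ = lcm, ⊔ = gcd)`. -/
def arithP (a y b x z : ℕ) : ℕ :=
  Nat.gcd (Nat.lcm b (Nat.gcd z (Nat.lcm a y)))
    (Nat.gcd (Nat.lcm z (Nat.gcd b (Nat.lcm x y)))
      (Nat.gcd (Nat.lcm x (Nat.gcd a (Nat.lcm z y)))
        (Nat.lcm a (Nat.gcd x (Nat.lcm b y)))))

theorem Nat.Prime.pow_dvd_lcm_iff {p : ℕ} (hp : p.Prime) (k b c : ℕ) :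
    p ^ k ∣ Nat.lcm b c ↔ p ^ k ∣ b ∨ p ^ k ∣ c := by
  rcases eq_or_ne b 0 with rfl | hb
  · simp
  rcases eq_or_ne c 0 with rfl | hc
  · simp
  rw [hp.pow_dvd_iff_le_factorization (Nat.lcm_ne_zero hb hc),
    hp.pow_dvd_iff_le_factorization hb, hp.pow_dvd_iff_le_factorization hc,
    Nat.factorization_lcm hb hc, Finsupp.sup_apply, le_sup_iff]

/-- Exchanging `a` with `b` and `x` with `z` leaves the principal product unchanged. -/
theorem arithP_swap (a y b x z : ℕ) : arithP a y b x z = arithP b y a z x := by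
  refine Nat.eq_of_forall_prime_pow_dvd_iff fun p k hp => ?_
  simp only [arithP, Nat.dvd_gcd_iff, hp.pow_dvd_lcm_iff]
  tauto

theorem arithP_eq_of_modEq {y b x x' : ℕ} (a z : ℕ) (h : x ≡ x' [MOD Nat.lcm y b]) :
    arithP a y b x z = arithP a y b x' z := by
  refine Nat.eq_of_forall_prime_pow_dvd_iff fun p k hp => ?_
  have hx : p ^ k ∣ Nat.gcd x (Nat.lcm y b) ↔ p ^ k ∣ Nat.gcd x' (Nat.lcm y b) := by
    rw [h.gcd_eq]
  simp only [arithP, Nat.dvd_gcd_iff, hp.pow_dvd_lcm_iff] at hx ⊢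
  grind

/-- If `lcm(a,y,b) ≠ 0`, then `P(x,z)` is always a multiple of `gcd(a,y,b)` and a
divisor of `lcm(a,y,b)`, and `P` is periodic with line period `lcm(y,b)` and column
period `lcm(y,a)`. -/
theorem arithP_bounded_and_periodic (a y b : ℕ) (hN : Nat.lcm a (Nat.lcm y b) ≠ 0) :
    (∀ x z : ℕ,
      Nat.gcd a (Nat.gcd y b) ∣ arithP a y b x z ∧
      arithP a y b x z ∣ Nat.lcm a (Nat.lcm y b)) ∧
    (∀ x x' z : ℕ, x ≡ x' [MOD Nat.lcm y b] → arithP a y b x z = arithP a y b x' z) ∧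
    (∀ x z z' : ℕ, z ≡ z' [MOD Nat.lcm y a] → arithP a y b x z = arithP a y b x z') := by
  refine ⟨fun x z => ⟨?_, ?_⟩, fun x x' z h => arithP_eq_of_modEq a z h, fun x z z' h => ?_⟩
  · refine (Nat.dvd_iff_prime_pow_dvd_dvd _ _).2 fun p k hp => ?_
    simp only [arithP, Nat.dvd_gcd_iff, hp.pow_dvd_lcm_iff]
    tauto
  · refine (Nat.dvd_iff_prime_pow_dvd_dvd _ _).2 fun p k hp => ?_
    simp only [arithP, Nat.dvd_gcd_iff, hp.pow_dvd_lcm_iff]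
    tauto
  · rw [arithP_swap a y b x z, arithP_swap a y b x z', arithP_eq_of_modEq b x h]
end
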